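/- Let p be a prime, q = p², let N ≥ 1 be a divisor of q−1, and let n ∈ ℕ. Then the polynomial (x^q − x)^{N·p^n − 1} ∈ F_q[x] is perfect. -/

import Mathlib

open Polynomial

/-- The sum of all monic divisors of a polynomial. -/
noncomputable def polySigma {F : Type*} [Field F] (A : F[X]) : F[X] :=
  ∑ᶠ d ∈ {d : F[X] | d.Monic ∧ d ∣ A}, d

/-- A polynomial is perfect if it equals the sum of its monic divisors. -/
def IsPerfectPoly {F : Type*} [Field F] (A : F[X]) : Prop := polySigma A = A

theorem rootMultiplicity_prod_X_sub_C_pow {F : Type*} [Field F] [Fintype F] (f : F → ℕ) (a : F) :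
    (∏ b, (X - C b : F[X]) ^ f b).rootMultiplicity a = f a := by
  classical
  have h0 : (∏ b, (X - C b : F[X]) ^ f b) ≠ 0 :=
    Finset.prod_ne_zero_iff.mpr fun b _ => pow_ne_zero _ (X_sub_C_ne_zero b)
  rw [← count_roots, roots_prod _ _ h0, Multiset.count_bind, Finset.sum_map_val]
  simp [roots_pow, Multiset.count_singleton]

theorem Polynomial.Monic.eq_prod_X_sub_C_pow_rootMultiplicity {F : Type*} [Field F] [Fintype F]
    {d : F[X]} (hd : d.Monic) (hs : d.Splits) :
    d = ∏ a, (X - C a) ^ d.rootMultiplicity a := by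
  classical
  conv_lhs => rw [hs.eq_prod_roots_of_monic hd, Finset.prod_multiset_map_count]
  simp only [count_roots]
  refine Finset.prod_subset (Finset.subset_univ _) fun a _ ha => ?_
  rw [← count_roots, Multiset.count_eq_zero_of_notMem (by simpa using ha), pow_zero]

/-- The divisor sum of a power of `∏ a, (X - C a)` factors over the points of the field. -/
theorem polySigma_prod_X_sub_C_pow {F : Type*} [Field F] [Fintype F] (m : ℕ) :
    polySigma ((∏ a, (X - C a) : F[X]) ^ m) =
      ∏ a, ∑ i ∈ Finset.range (m + 1), (X - C a : F[X]) ^ i := by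
  classical
  rw [Finset.prod_univ_sum, polySigma, ← finsum_mem_coe_finset]
  symm
  rw [← Finset.prod_pow]
  have h0 : (∏ b, (X - C b : F[X]) ^ m) ≠ 0 :=
    Finset.prod_ne_zero_iff.mpr fun b _ => pow_ne_zero _ (X_sub_C_ne_zero b)
  refine finsum_mem_eq_of_bijOn (fun f : F → ℕ => ∏ a, (X - C a : F[X]) ^ f a)
    ⟨?_, ?_, ?_⟩ fun _ _ => rfl
  · intro f hf
    simp only [Finset.mem_coe, Fintype.mem_piFinset, Finset.mem_range, Nat.lt_succ_iff] at hf
    exact ⟨monic_prod_of_monic _ _ fun a _ => (monic_X_sub_C a).pow _,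
      Finset.prod_dvd_prod_of_dvd _ _ fun a _ => pow_dvd_pow _ (hf a)⟩
  · intro f _ g _ hfg
    funext a
    rw [← rootMultiplicity_prod_X_sub_C_pow f a, ← rootMultiplicity_prod_X_sub_C_pow g a]
    exact congrArg (rootMultiplicity a) hfg
  · rintro d ⟨hd, hdvd⟩
    have hs : (∏ b, (X - C b : F[X]) ^ m).Splits :=
      Splits.prod fun b _ => (Splits.X_sub_C b).pow m
    refine ⟨fun a => d.rootMultiplicity a, ?_,
      (hd.eq_prod_X_sub_C_pow_rootMultiplicity (hs.of_dvd h0 hdvd)).symm⟩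
    simp only [Finset.mem_coe, Fintype.mem_piFinset, Finset.mem_range, Nat.lt_succ_iff]
    intro a
    rw [← rootMultiplicity_prod_X_sub_C_pow (fun _ : F => m) a]
    exact rootMultiplicity_le_rootMultiplicity_of_dvd h0 hdvd a

theorem FiniteField.X_pow_card_sub_X_eq_prod (F : Type*) [Field F] [Fintype F] :
    (X ^ Fintype.card F - X : F[X]) = ∏ a, (X - C a) := by
  have hroots := FiniteField.roots_X_pow_card_sub_X F
  have hdeg := FiniteField.X_pow_card_sub_X_natDegree_eq F (Fintype.one_lt_card (α := F))
  have hm : (X ^ Fintype.card F - X : F[X]).Monic :=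
    monic_X_pow_sub (by rw [degree_X]; exact_mod_cast Fintype.one_lt_card)
  have h := prod_multiset_X_sub_C_of_monic_of_roots_card_eq hm
    (by rw [hroots, hdeg]; exact Finset.card_univ)
  rw [hroots] at h
  exact h.symm

theorem FiniteField.exists_isPrimitiveRoot_of_dvd {F : Type*} [Field F] [Fintype F] {N : ℕ}
    (hN : N ∣ Fintype.card F - 1) : ∃ ζ : F, IsPrimitiveRoot ζ N := by
  obtain ⟨g, hg⟩ := IsCyclic.exists_ofOrder_eq_natCard (α := Fˣ)
  rw [Nat.card_units, Nat.card_eq_fintype_card] at hg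
  obtain ⟨k, hk⟩ := hN
  have hpos : 0 < Fintype.card F - 1 := Nat.sub_pos_of_lt Fintype.one_lt_card
  have h := (IsPrimitiveRoot.orderOf g).pow (hg ▸ hpos) (a := k) (b := N) (by rw [hg, hk, mul_comm])
  exact ⟨_, IsPrimitiveRoot.coe_units_iff.mpr h⟩

theorem FiniteField.prod_X_sub_C_sub_C {F : Type*} [Field F] [Fintype F] (c : F) :
    (∏ a, (X - C a - C c) : F[X]) = ∏ a, (X - C a) :=
  Fintype.prod_equiv (Equiv.addRight c) _ _ fun a => by simp [sub_sub]

theorem FiniteField.prod_X_sub_C_pow_sub_one {F : Type*} [Field F] [Fintype F] {N : ℕ}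
    (hN1 : 1 ≤ N) (hN : N ∣ Fintype.card F - 1) :
    (∏ a, ((X - C a) ^ N - 1) : F[X]) = (∏ a, (X - C a)) ^ N := by
  obtain ⟨ζ, hζ⟩ := FiniteField.exists_isPrimitiveRoot_of_dvd hN
  have h (a : F) :
      ((X - C a) ^ N - 1 : F[X]) = ∏ c ∈ nthRootsFinset N (1 : F), (X - C a - C c) := by
    simpa [Polynomial.prod_comp] using
      congrArg (fun P : F[X] => P.comp (X - C a)) (X_pow_sub_one_eq_prod hN1 hζ)
  rw [Finset.prod_congr rfl fun a _ => h a, Finset.prod_comm]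
  simp_rw [FiniteField.prod_X_sub_C_sub_C]
  rw [Finset.prod_const, hζ.card_nthRootsFinset]

theorem stmt17 (p : ℕ) (hp : p.Prime) (F : Type*) [Field F] [Fintype F]
    (hcard : Fintype.card F = p ^ 2)
    (N : ℕ) (hN1 : 1 ≤ N) (hNq : N ∣ p ^ 2 - 1) (n : ℕ) :
    IsPerfectPoly ((X ^ (p ^ 2) - X : F[X]) ^ (N * p ^ n - 1)) := by
  have : Fact p.Prime := ⟨hp⟩
  have : CharP F p := charP_of_card_eq_prime_pow hcard
  have hpos : 0 < N * p ^ n := Nat.mul_pos hN1 (pow_pos hp.pos n)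
  rw [IsPerfectPoly, ← hcard, FiniteField.X_pow_card_sub_X_eq_prod, polySigma_prod_X_sub_C_pow,
    Nat.sub_add_cancel hpos]
  have h0 : (∏ a, (X - C a) : F[X]) ≠ 0 :=
    Finset.prod_ne_zero_iff.mpr fun a _ => X_sub_C_ne_zero a
  apply mul_right_cancel₀ h0
  rw [← pow_succ, Nat.sub_add_cancel hpos, pow_mul,
    ← FiniteField.prod_X_sub_C_pow_sub_one hN1 (hcard ▸ hNq), ← Finset.prod_pow,
    ← FiniteField.prod_X_sub_C_sub_C (1 : F), ← Finset.prod_mul_distrib]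
  refine Finset.prod_congr rfl fun a _ => ?_
  rw [C_1, geom_sum_mul, sub_pow_char_pow, one_pow, pow_mul]
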